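/- Suppose P is a unit parallel vector field: g(P,P) = 1 and ∇P = 0 (i.e. ∇_X P = 0 for all vector fields X). Then ∇S ≡ 0 if and only if for all vector fields X, Y, Z: (∇̄_X Ŝ)(Y,Z) = −π(Y)·S̄(X,Z) − π(Z)·S̄(X,Y). -/

import Mathlib

open scoped BigOperators

/-! Setup: an open set `U ⊆ ℝⁿ` with a Riemannian metric given by component functions
`g x i j`, the Levi-Civita connection computed from the Christoffel symbols, the
semi-symmetric metric connection `∇̄_X Y = ∇_X Y + π(Y)X − g(X,Y)P`, curvature and
Ricci tensors of a connection, and covariant derivatives of `(0,2)`-tensors. -/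

/-- A vector field on (an open subset of) `ℝⁿ`. -/
abbrev VF (n : ℕ) := (Fin n → ℝ) → Fin n → ℝ

/-- Partial derivative `∂ᵢ f` of a real-valued function. -/
noncomputable def pd {n : ℕ} (i : Fin n) (f : (Fin n → ℝ) → ℝ) (x : Fin n → ℝ) : ℝ :=
  fderiv ℝ f x (Pi.single i 1)

/-- The metric evaluated on two tangent vectors at the point `x`. -/
def gval {n : ℕ} (g : (Fin n → ℝ) → Fin n → Fin n → ℝ) (x v w : Fin n → ℝ) : ℝ :=
  ∑ i, ∑ j, g x i j * v i * w j

/-- The Christoffel symbols `Γ^k_{ij} = ½ g^{kl}(∂ᵢ g_{jl} + ∂ⱼ g_{il} − ∂_l g_{ij})`. -/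
noncomputable def christoffel {n : ℕ} (g : (Fin n → ℝ) → Fin n → Fin n → ℝ)
    (x : Fin n → ℝ) (k i j : Fin n) : ℝ :=
  (1 / 2) * ∑ l, (Matrix.of (g x))⁻¹ k l *
    (pd i (fun y => g y j l) x + pd j (fun y => g y i l) x - pd l (fun y => g y i j) x)

/-- The Levi-Civita covariant derivative `(∇_X Y)^k = X^i ∂ᵢ Y^k + Γ^k_{ij} X^i Y^j`. -/
noncomputable def lcCov {n : ℕ} (g : (Fin n → ℝ) → Fin n → Fin n → ℝ)
    (X Y : VF n) (x : Fin n → ℝ) : Fin n → ℝ :=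
  fun k => fderiv ℝ (fun y => Y y k) x (X x) +
    ∑ i, ∑ j, christoffel g x k i j * X x i * Y x j

/-- The semi-symmetric metric connection `∇̄_X Y = ∇_X Y + π(Y)X − g(X,Y)P`,
where `π(X) = g(X,P)`. -/
noncomputable def ssCov {n : ℕ} (g : (Fin n → ℝ) → Fin n → Fin n → ℝ)
    (P : VF n) (X Y : VF n) (x : Fin n → ℝ) : Fin n → ℝ :=
  fun k => lcCov g X Y x k + gval g x (Y x) (P x) * X x k - gval g x (X x) (Y x) * P x k

/-- The Lie bracket of vector fields. -/
noncomputable def lie {n : ℕ} (X Y : VF n) (x : Fin n → ℝ) : Fin n → ℝ :=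
  fun k => fderiv ℝ (fun y => Y y k) x (X x) - fderiv ℝ (fun y => X y k) x (Y x)

/-- The curvature `R_D(X,Y)Z = D_X D_Y Z − D_Y D_X Z − D_{[X,Y]}Z` of a connection `D`. -/
noncomputable def curv {n : ℕ} (D : VF n → VF n → VF n) (X Y Z : VF n)
    (x : Fin n → ℝ) : Fin n → ℝ :=
  fun k => D X (D Y Z) x k - D Y (D X Z) x k - D (lie X Y) Z x k

/-- The Ricci tensor `Ric_D(Y,Z) = trace (X ↦ R_D(X,Y)Z)` of a connection `D`
(the trace computed in the coordinate frame). -/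
noncomputable def ricci {n : ℕ} (D : VF n → VF n → VF n) (Y Z : VF n)
    (x : Fin n → ℝ) : ℝ :=
  ∑ i, curv D (fun _ => Pi.single i 1) Y Z x i

/-- The symmetrization `Ŝ(Y,Z) = ½(S̄(Y,Z) + S̄(Z,Y))` of the Ricci tensor of the
semi-symmetric metric connection. -/
noncomputable def shat {n : ℕ} (g : (Fin n → ℝ) → Fin n → Fin n → ℝ)
    (P : VF n) (Y Z : VF n) (x : Fin n → ℝ) : ℝ :=
  (ricci (ssCov g P) Y Z x + ricci (ssCov g P) Z Y x) / 2

/-- The covariant derivative `(D_X T)(Y,Z) = X(T(Y,Z)) − T(D_X Y, Z) − T(Y, D_X Z)` of a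
`(0,2)`-tensor `T` along the connection `D`. -/
noncomputable def covT {n : ℕ} (D : VF n → VF n → VF n)
    (T : VF n → VF n → (Fin n → ℝ) → ℝ) (X Y Z : VF n) (x : Fin n → ℝ) : ℝ :=
  fderiv ℝ (T Y Z) x (X x) - T (D X Y) Z x - T Y (D X Z) x

/-- Smoothness of a vector-field/metric-type map on `U`. -/
def SmoothVF {n : ℕ} {E : Type*} [NormedAddCommGroup E] [NormedSpace ℝ E]
    (U : Set (Fin n → ℝ)) (f : (Fin n → ℝ) → E) : Prop :=
  ContDiffOn ℝ (⊤ : ℕ∞) f U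


/-! ### General connections given by coefficient functions -/

/-- The connection with coefficients `G x k i j`. -/
noncomputable def genCov {n : ℕ} (G : (Fin n → ℝ) → Fin n → Fin n → Fin n → ℝ)
    (X Y : VF n) (x : Fin n → ℝ) : Fin n → ℝ :=
  fun k => fderiv ℝ (fun y => Y y k) x (X x) + ∑ i, ∑ j, G x k i j * X x i * Y x j

/-- Scalar smoothness on `U`. -/
def Sm {n : ℕ} (U : Set (Fin n → ℝ)) (f : (Fin n → ℝ) → ℝ) : Prop :=
  ContDiffOn ℝ (⊤ : ℕ∞) f U

/-- Components of the Ricci tensor. -/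
noncomputable def rc {n : ℕ} (G : (Fin n → ℝ) → Fin n → Fin n → Fin n → ℝ)
    (x : Fin n → ℝ) (j l : Fin n) : ℝ :=
  ∑ i, (pd i (fun y => G y i j l) x - pd j (fun y => G y i i l) x
    + ∑ m, (G x i i m * G x m j l - G x i j m * G x m i l))

section basics
variable {n : ℕ} {U : Set (Fin n → ℝ)}

theorem Sm.diff {f : (Fin n → ℝ) → ℝ} (hf : Sm U f) (hU : IsOpen U) {x} (hx : x ∈ U) :
    DifferentiableAt ℝ f x :=
  (hf.contDiffAt (hU.mem_nhds hx)).differentiableAt (by simp)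

theorem Sm.add {f h : (Fin n → ℝ) → ℝ} (hf : Sm U f) (hh : Sm U h) :
    Sm U (fun y => f y + h y) := ContDiffOn.add hf hh

theorem Sm.sub {f h : (Fin n → ℝ) → ℝ} (hf : Sm U f) (hh : Sm U h) :
    Sm U (fun y => f y - h y) := ContDiffOn.sub hf hh

theorem Sm.mul {f h : (Fin n → ℝ) → ℝ} (hf : Sm U f) (hh : Sm U h) :
    Sm U (fun y => f y * h y) := ContDiffOn.mul hf hh

theorem Sm.const (c : ℝ) : Sm U (fun _ => c) := contDiffOn_const

theorem Sm.sum {ι : Type*} {s : Finset ι} {f : ι → (Fin n → ℝ) → ℝ} (hf : ∀ i, Sm U (f i)) :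
    Sm U (fun y => ∑ i ∈ s, f i y) := ContDiffOn.sum (fun i _ => hf i)

theorem Sm.congr {f h : (Fin n → ℝ) → ℝ} (hf : Sm U f) (hh : ∀ x ∈ U, h x = f x) : Sm U h :=
  ContDiffOn.congr hf hh

theorem Sm.pd {f : (Fin n → ℝ) → ℝ} (hf : Sm U f) (hU : IsOpen U) (i : Fin n) :
    Sm U (pd i f) := by
  have h : ContDiffOn ℝ (⊤ : ℕ∞) (fderiv ℝ f) U :=
    ContDiffOn.fderiv_of_isOpen hf hU (by simp)
  exact h.clm_apply contDiffOn_const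

theorem smooth_comp {X : VF n} (hX : SmoothVF U X) (i : Fin n) : Sm U (fun y => X y i) :=
  (contDiffOn_pi.1 hX) i

theorem fderiv_eq_sum (f : (Fin n → ℝ) → ℝ) (x v : Fin n → ℝ) :
    fderiv ℝ f x v = ∑ i, v i * pd i f x := by
  conv_lhs => rw [← Finset.univ_sum_single v]
  rw [map_sum]
  refine Finset.sum_congr rfl fun i _ => ?_
  have : (Pi.single i (v i) : Fin n → ℝ) = v i • Pi.single i 1 := by
    rw [← Pi.single_smul]; simp
  rw [this, map_smul]; rfl

theorem pd_add' {f h : (Fin n → ℝ) → ℝ} {x} (hf : DifferentiableAt ℝ f x)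
    (hh : DifferentiableAt ℝ h x) (i : Fin n) :
    pd i (fun y => f y + h y) x = pd i f x + pd i h x := by
  simp only [pd]; rw [fderiv_fun_add hf hh]; rfl

theorem pd_sub' {f h : (Fin n → ℝ) → ℝ} {x} (hf : DifferentiableAt ℝ f x)
    (hh : DifferentiableAt ℝ h x) (i : Fin n) :
    pd i (fun y => f y - h y) x = pd i f x - pd i h x := by
  simp only [pd]; rw [fderiv_fun_sub hf hh]; rfl

theorem pd_mul' {f h : (Fin n → ℝ) → ℝ} {x} (hf : DifferentiableAt ℝ f x)
    (hh : DifferentiableAt ℝ h x) (i : Fin n) :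
    pd i (fun y => f y * h y) x = pd i f x * h x + f x * pd i h x := by
  simp only [pd]; rw [fderiv_fun_mul hf hh]; simp; ring

theorem pd_const' (c : ℝ) (i : Fin n) (x) : pd i (fun _ => c) x = 0 := by
  simp [pd]

theorem pd_sum' {ι : Type*} {s : Finset ι} {f : ι → (Fin n → ℝ) → ℝ} {x}
    (hf : ∀ i, DifferentiableAt ℝ (f i) x) (j : Fin n) :
    pd j (fun y => ∑ i ∈ s, f i y) x = ∑ i ∈ s, pd j (f i) x := by
  simp only [pd]; rw [fderiv_fun_sum (fun i _ => hf i)]; simp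

theorem pd_congr {f h : (Fin n → ℝ) → ℝ} (hU : IsOpen U) {x} (hx : x ∈ U)
    (hfh : ∀ y ∈ U, f y = h y) (i : Fin n) : pd i f x = pd i h x := by
  simp only [pd]
  rw [Filter.EventuallyEq.fderiv_eq]
  filter_upwards [hU.mem_nhds hx] with y hy using hfh y hy

theorem pd_comm {f : (Fin n → ℝ) → ℝ} (hf : Sm U f) (hU : IsOpen U) {x} (hx : x ∈ U)
    (i j : Fin n) : pd i (pd j f) x = pd j (pd i f) x := by
  have hc : ContDiffAt ℝ (⊤ : ℕ∞) f x := hf.contDiffAt (hU.mem_nhds hx)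
  have hs := hc.isSymmSndFDerivAt (by
    simp only [minSmoothness_of_isRCLikeNormedField]
    exact WithTop.coe_le_coe.2 (le_top : (2 : ℕ∞) ≤ ⊤))
  have hd : DifferentiableAt ℝ (fderiv ℝ f) x := by
    have h : ContDiffOn ℝ (⊤ : ℕ∞) (fderiv ℝ f) U :=
      ContDiffOn.fderiv_of_isOpen hf hU (by simp)
    exact (h.contDiffAt (hU.mem_nhds hx)).differentiableAt (by simp)
  have key : ∀ a b : Fin n, pd a (pd b f) x
      = fderiv ℝ (fderiv ℝ f) x (Pi.single a 1) (Pi.single b 1) := by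
    intro a b
    change fderiv ℝ (fun y => fderiv ℝ f y (Pi.single b 1)) x (Pi.single a 1) = _
    rw [fderiv_clm_apply hd (differentiableAt_const _)]
    simp
  rw [key, key]; exact hs _ _

theorem smooth_const (v : Fin n → ℝ) : SmoothVF U (fun _ => v : VF n) := contDiffOn_const

theorem genCov_eq (G : (Fin n → ℝ) → Fin n → Fin n → Fin n → ℝ) (X Y : VF n) (x) (k : Fin n) :
    genCov G X Y x k = ∑ i, X x i * (pd i (fun y => Y y k) x + ∑ j, G x k i j * Y x j) := by
  simp only [genCov, fderiv_eq_sum, mul_add, Finset.sum_add_distrib, Finset.mul_sum]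
  congr 1
  refine Finset.sum_congr rfl fun i _ => Finset.sum_congr rfl fun j _ => by ring

theorem genCov_single (G : (Fin n → ℝ) → Fin n → Fin n → Fin n → ℝ) (Y : VF n) (x) (i k : Fin n) :
    genCov G (fun _ => Pi.single i 1) Y x k = pd i (fun y => Y y k) x + ∑ j, G x k i j * Y x j := by
  rw [genCov_eq, Finset.sum_eq_single i]
  · simp
  · intro b _ hb; simp [hb]
  · simp

theorem genCov_smooth {G : (Fin n → ℝ) → Fin n → Fin n → Fin n → ℝ} (hU : IsOpen U)
    (hG : ∀ k i j, Sm U (fun y => G y k i j)) {X Y : VF n} (hX : SmoothVF U X)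
    (hY : SmoothVF U Y) : SmoothVF U (genCov G X Y) := by
  refine contDiffOn_pi.2 fun k => ?_
  have : (fun y => genCov G X Y y k) = fun x => ∑ i, X x i * (pd i (fun y => Y y k) x + ∑ j, G x k i j * Y x j) :=
    funext fun y => genCov_eq G X Y y k
  rw [this]
  exact Sm.sum fun i => (smooth_comp hX i).mul
    (((smooth_comp hY k).pd hU i).add (Sm.sum fun j => (hG k i j).mul (smooth_comp hY j)))

theorem curv_single {G : (Fin n → ℝ) → Fin n → Fin n → Fin n → ℝ} (hU : IsOpen U)
    (hG : ∀ k i j, Sm U (fun y => G y k i j)) {Y Z : VF n} (hY : SmoothVF U Y)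
    (hZ : SmoothVF U Z) {x} (hx : x ∈ U) (i k : Fin n) :
    curv (genCov G) (fun _ => Pi.single i 1) Y Z x k =
      ∑ j, ∑ l, (pd i (fun y => G y k j l) x - pd j (fun y => G y k i l) x
        + ∑ m, (G x k i m * G x m j l - G x k j m * G x m i l)) * Y x j * Z x l := by
  have hYs := smooth_comp hY
  have hZs := smooth_comp hZ
  have lieE : ∀ j, lie (fun _ => Pi.single i 1) Y x j = pd i (fun y => Y y j) x := by
    intro j; simp [lie, pd]
  unfold curv
  rw [genCov_single, genCov_eq, genCov_eq]
  simp only [lieE]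
  have e1 : pd i (fun y => genCov G Y Z y k) x = ∑ j, (pd i (fun y => Y y j) x
      * (pd j (fun y => Z y k) x + ∑ l, G x k j l * Z x l)
      + Y x j * (pd i (pd j (fun y => Z y k)) x + ∑ l, (pd i (fun y => G y k j l) x * Z x l
        + G x k j l * pd i (fun y => Z y l) x))) := by
    rw [show (fun y => genCov G Y Z y k) = _ from funext fun y => genCov_eq G Y Z y k]
    rw [pd_sum' (fun j => (Sm.mul (hYs j) (((hZs k).pd hU j).add (Sm.sum fun l => (hG k j l).mul (hZs l)))).diff hU hx)]
    refine Finset.sum_congr rfl fun j _ => ?_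
    rw [pd_mul' ((hYs j).diff hU hx) ((((hZs k).pd hU j).add (Sm.sum fun l => (hG k j l).mul (hZs l))).diff hU hx)]
    rw [pd_add' (((hZs k).pd hU j).diff hU hx) ((Sm.sum fun l => (hG k j l).mul (hZs l)).diff hU hx)]
    rw [pd_sum' (fun l => ((hG k j l).mul (hZs l)).diff hU hx)]
    congr 3
    refine Finset.sum_congr rfl fun l _ => ?_
    rw [pd_mul' ((hG k j l).diff hU hx) ((hZs l).diff hU hx)]
  have e2 : ∀ j, pd j (fun y => genCov G (fun _ => Pi.single i 1) Z y k) x =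
      pd j (pd i (fun y => Z y k)) x + ∑ l, (pd j (fun y => G y k i l) x * Z x l
        + G x k i l * pd j (fun y => Z y l) x) := by
    intro j
    rw [show (fun y => genCov G (fun _ => Pi.single i 1) Z y k) = _ from
      funext fun y => genCov_single G Z y i k]
    rw [pd_add' (((hZs k).pd hU i).diff hU hx) ((Sm.sum fun l => (hG k i l).mul (hZs l)).diff hU hx)]
    rw [pd_sum' (fun l => ((hG k i l).mul (hZs l)).diff hU hx)]
    congr 1
    refine Finset.sum_congr rfl fun l _ => ?_
    rw [pd_mul' ((hG k i l).diff hU hx) ((hZs l).diff hU hx)]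
  rw [e1]
  simp only [e2]
  simp only [genCov_single]
  simp only [genCov_eq]
  have e3 : ∑ m, G x k i m * ∑ j, Y x j * (pd j (fun y => Z y m) x + ∑ l, G x m j l * Z x l)
      = ∑ j, Y x j * (∑ m, G x k i m * pd j (fun y => Z y m) x
          + ∑ l, (∑ m, G x k i m * G x m j l) * Z x l) := by
    simp only [Finset.mul_sum, mul_add, Finset.sum_add_distrib, Finset.sum_mul]
    congr 1
    · rw [Finset.sum_comm]
      refine Finset.sum_congr rfl fun j _ => Finset.sum_congr rfl fun m _ => by ring
    · rw [Finset.sum_comm]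
      refine Finset.sum_congr rfl fun j _ => ?_
      rw [Finset.sum_comm]
      refine Finset.sum_congr rfl fun j _ => Finset.sum_congr rfl fun m _ => by ring
  rw [e3, ← Finset.sum_add_distrib, ← Finset.sum_sub_distrib, ← Finset.sum_sub_distrib]
  refine Finset.sum_congr rfl fun j _ => ?_
  have e4 : ∑ m, G x k j m * (pd i (fun y => Z y m) x + ∑ l, G x m i l * Z x l)
      = ∑ m, G x k j m * pd i (fun y => Z y m) x + ∑ l, (∑ m, G x k j m * G x m i l) * Z x l := by
    simp only [Finset.mul_sum, mul_add, Finset.sum_add_distrib, Finset.sum_mul]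
    congr 1
    rw [Finset.sum_comm]
    refine Finset.sum_congr rfl fun j _ => Finset.sum_congr rfl fun m _ => by ring
  rw [e4, pd_comm (hZs k) hU hx i j]
  have e5 : ∑ l, (pd i (fun y => G y k j l) x - pd j (fun y => G y k i l) x
        + ∑ m, (G x k i m * G x m j l - G x k j m * G x m i l)) * Y x j * Z x l
      = Y x j * (∑ l, pd i (fun y => G y k j l) x * Z x l - ∑ l, pd j (fun y => G y k i l) x * Z x l
        + ∑ l, (∑ m, G x k i m * G x m j l) * Z x l - ∑ l, (∑ m, G x k j m * G x m i l) * Z x l) := by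
    rw [← Finset.sum_sub_distrib, ← Finset.sum_add_distrib, ← Finset.sum_sub_distrib, Finset.mul_sum]
    refine Finset.sum_congr rfl fun l _ => ?_
    rw [Finset.sum_sub_distrib]; ring
  rw [e5]
  simp only [Finset.sum_add_distrib]
  ring

theorem ricci_eq {G : (Fin n → ℝ) → Fin n → Fin n → Fin n → ℝ} (hU : IsOpen U)
    (hG : ∀ k i j, Sm U (fun y => G y k i j)) {Y Z : VF n} (hY : SmoothVF U Y)
    (hZ : SmoothVF U Z) {x} (hx : x ∈ U) :
    ricci (genCov G) Y Z x = ∑ j, ∑ l, rc G x j l * Y x j * Z x l := by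
  unfold ricci
  simp only [curv_single hU hG hY hZ hx]
  rw [Finset.sum_comm]
  refine Finset.sum_congr rfl fun j _ => ?_
  rw [Finset.sum_comm]
  refine Finset.sum_congr rfl fun l _ => ?_
  rw [rc, Finset.sum_mul, Finset.sum_mul]

theorem rc_smooth {G : (Fin n → ℝ) → Fin n → Fin n → Fin n → ℝ} (hU : IsOpen U)
    (hG : ∀ k i j, Sm U (fun y => G y k i j)) (j l : Fin n) : Sm U (fun y => rc G y j l) :=
  Sm.sum fun i => (((hG i j l).pd hU i).sub ((hG i i l).pd hU j)).add
    (Sm.sum fun m => ((hG i i m).mul (hG m j l)).sub ((hG i j m).mul (hG m i l)))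

theorem covT_eq {G : (Fin n → ℝ) → Fin n → Fin n → Fin n → ℝ} (hU : IsOpen U)
    (hG : ∀ k i j, Sm U (fun y => G y k i j))
    {T : VF n → VF n → (Fin n → ℝ) → ℝ} {t : (Fin n → ℝ) → Fin n → Fin n → ℝ}
    (ht : ∀ j l, Sm U (fun y => t y j l))
    (hT : ∀ Y Z, SmoothVF U Y → SmoothVF U Z → ∀ x ∈ U, T Y Z x = ∑ j, ∑ l, t x j l * Y x j * Z x l)
    {X Y Z : VF n} (hX : SmoothVF U X) (hY : SmoothVF U Y) (hZ : SmoothVF U Z) {x} (hx : x ∈ U) :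
    covT (genCov G) T X Y Z x = ∑ i, ∑ j, ∑ l, (pd i (fun y => t y j l) x
      - ∑ m, G x m i j * t x m l - ∑ m, G x m i l * t x j m) * X x i * Y x j * Z x l := by
  have hYs := smooth_comp hY
  have hZs := smooth_comp hZ
  unfold covT
  rw [hT _ _ (genCov_smooth hU hG hX hY) hZ x hx, hT _ _ hY (genCov_smooth hU hG hX hZ) x hx]
  rw [fderiv_eq_sum]
  simp only [genCov_eq]
  have e1 : ∀ i, pd i (T Y Z) x = ∑ j, ∑ l, ((pd i (fun y => t y j l) x * Y x j
      + t x j l * pd i (fun y => Y y j) x) * Z x l + t x j l * Y x j * pd i (fun y => Z y l) x) := by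
    intro i
    rw [pd_congr hU hx (hT Y Z hY hZ) i]
    rw [pd_sum' fun j => (Sm.sum fun l => ((ht j l).mul (hYs j)).mul (hZs l)).diff hU hx]
    refine Finset.sum_congr rfl fun j _ => ?_
    rw [pd_sum' fun l => (((ht j l).mul (hYs j)).mul (hZs l)).diff hU hx]
    refine Finset.sum_congr rfl fun l _ => ?_
    rw [pd_mul' (((ht j l).mul (hYs j)).diff hU hx) ((hZs l).diff hU hx),
      pd_mul' ((ht j l).diff hU hx) ((hYs j).diff hU hx)]
  simp only [e1]
  have e2 : ∑ j, ∑ l, t x j l * (∑ i, X x i * (pd i (fun y => Y y j) x + ∑ a, G x j i a * Y x a)) * Z x l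
      = ∑ i, X x i * (∑ j, ∑ l, t x j l * pd i (fun y => Y y j) x * Z x l
        + ∑ j, ∑ l, (∑ m, G x m i j * t x m l) * Y x j * Z x l) := by
    simp only [Finset.mul_sum, mul_add, Finset.sum_add_distrib, Finset.sum_mul, add_mul]
    congr 1
    · rw [Finset.sum_comm_cycle]
      refine Finset.sum_congr rfl fun i _ => Finset.sum_congr rfl fun j _ => Finset.sum_congr rfl fun l _ => by ring
    · rw [Finset.sum_comm_cycle]
      refine Finset.sum_congr rfl fun i _ => ?_
      rw [Finset.sum_comm_cycle]
      refine Finset.sum_congr rfl fun j _ => ?_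
      rw [Finset.sum_comm]
      refine Finset.sum_congr rfl fun l _ => Finset.sum_congr rfl fun m _ => by ring
  have e3 : ∑ j, ∑ l, t x j l * Y x j * (∑ i, X x i * (pd i (fun y => Z y l) x + ∑ a, G x l i a * Z x a))
      = ∑ i, X x i * (∑ j, ∑ l, t x j l * Y x j * pd i (fun y => Z y l) x
        + ∑ j, ∑ l, (∑ m, G x m i l * t x j m) * Y x j * Z x l) := by
    simp only [Finset.mul_sum, mul_add, Finset.sum_add_distrib, Finset.sum_mul, add_mul]
    congr 1
    · rw [Finset.sum_comm_cycle]
      refine Finset.sum_congr rfl fun i _ => Finset.sum_congr rfl fun j _ => Finset.sum_congr rfl fun l _ => by ring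
    · rw [Finset.sum_comm_cycle]
      refine Finset.sum_congr rfl fun i _ => ?_
      refine Finset.sum_congr rfl fun j _ => ?_
      rw [Finset.sum_comm]
      refine Finset.sum_congr rfl fun l _ => Finset.sum_congr rfl fun m _ => by ring
  rw [e2, e3, ← Finset.sum_sub_distrib, ← Finset.sum_sub_distrib]
  refine Finset.sum_congr rfl fun i _ => ?_
  rw [← mul_sub, ← mul_sub]
  simp only [← Finset.sum_add_distrib, ← Finset.sum_sub_distrib, Finset.mul_sum]
  refine Finset.sum_congr rfl fun j _ => Finset.sum_congr rfl fun l _ => ?_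
  ring

end basics

section metric
variable {n : ℕ} {U : Set (Fin n → ℝ)}

theorem Sm.det {M : (Fin n → ℝ) → Matrix (Fin n) (Fin n) ℝ} (hM : ∀ i j, Sm U (fun y => M y i j)) :
    Sm U (fun y => (M y).det) := by
  simp only [Matrix.det_apply']
  refine Sm.sum fun σ => (Sm.const _).mul ?_
  exact contDiffOn_prod fun i _ => hM _ _

theorem inv_smooth {g : (Fin n → ℝ) → Fin n → Fin n → ℝ} (hg : ∀ i j, Sm U (fun y => g y i j))
    (hdet : ∀ x ∈ U, (Matrix.of (g x)).det ≠ 0) (i j : Fin n) :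
    Sm U (fun y => (Matrix.of (g y))⁻¹ i j) := by
  have h1 : Sm U (fun y => (Matrix.of (g y)).det) := Sm.det (M := fun y => Matrix.of (g y)) hg
  have h2 : Sm U (fun y => ((Matrix.of (g y)).det)⁻¹) := ContDiffOn.inv h1 hdet
  have h3 : Sm U (fun y => (Matrix.of (g y)).adjugate i j) := by
    simp only [Matrix.adjugate_apply]
    refine Sm.det fun a b => ?_
    by_cases h : a = j
    · subst h; simp only [Matrix.updateRow_self]; exact Sm.const _
    · simp only [Matrix.updateRow_ne h]; exact hg a b
  simp only [Matrix.inv_def, Ring.inverse_eq_inv', Matrix.smul_apply, smul_eq_mul]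
  exact h2.mul h3

/-- Hypotheses on the metric, in components. -/
structure MetricOn (U : Set (Fin n → ℝ)) (g : (Fin n → ℝ) → Fin n → Fin n → ℝ) : Prop where
  isOpen : IsOpen U
  smooth : ∀ i j, Sm U (fun y => g y i j)
  symm : ∀ x ∈ U, ∀ i j, g x i j = g x j i
  det : ∀ x ∈ U, (Matrix.of (g x)).det ≠ 0

variable {g : (Fin n → ℝ) → Fin n → Fin n → ℝ}

theorem MetricOn.inv_mul (h : MetricOn U g) {x} (hx : x ∈ U) :
    (Matrix.of (g x))⁻¹ * Matrix.of (g x) = 1 :=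
  Matrix.nonsing_inv_mul _ (isUnit_iff_ne_zero.2 (h.det x hx))

theorem MetricOn.mul_inv (h : MetricOn U g) {x} (hx : x ∈ U) :
    Matrix.of (g x) * (Matrix.of (g x))⁻¹ = 1 :=
  Matrix.mul_nonsing_inv _ (isUnit_iff_ne_zero.2 (h.det x hx))

theorem MetricOn.inv_symm (h : MetricOn U g) {x} (hx : x ∈ U) (i j : Fin n) :
    (Matrix.of (g x))⁻¹ i j = (Matrix.of (g x))⁻¹ j i := by
  have : (Matrix.of (g x)).transpose = Matrix.of (g x) := by
    ext a b; exact h.symm x hx b a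
  rw [← Matrix.transpose_apply ((Matrix.of (g x))⁻¹) i j, Matrix.transpose_nonsing_inv, this]

theorem MetricOn.pd_symm (h : MetricOn U g) {x} (hx : x ∈ U) (k i j : Fin n) :
    pd k (fun y => g y i j) x = pd k (fun y => g y j i) x :=
  pd_congr h.isOpen hx (fun y hy => h.symm y hy i j) k

theorem MetricOn.chr_smooth (h : MetricOn U g) (k i j : Fin n) :
    Sm U (fun y => christoffel g y k i j) := by
  unfold christoffel
  refine (Sm.const _).mul (Sm.sum fun l => (inv_smooth h.smooth h.det k l).mul ?_)
  exact (((h.smooth j l).pd h.isOpen i).add ((h.smooth i l).pd h.isOpen j)).sub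
    ((h.smooth i j).pd h.isOpen l)

theorem MetricOn.chr_symm (h : MetricOn U g) {x} (hx : x ∈ U) (k i j : Fin n) :
    christoffel g x k i j = christoffel g x k j i := by
  unfold christoffel
  congr 1
  refine Finset.sum_congr rfl fun l _ => ?_
  rw [h.pd_symm hx l i j]; ring

theorem MetricOn.lower (h : MetricOn U g) {x} (hx : x ∈ U) (i j l : Fin n) :
    ∑ m, christoffel g x m i j * g x m l = (1 / 2) *
      (pd i (fun y => g y j l) x + pd j (fun y => g y i l) x - pd l (fun y => g y i j) x) := by
  unfold christoffel
  have e : ∀ a, ∑ m, g x l m * (Matrix.of (g x))⁻¹ m a = (1 : Matrix (Fin n) (Fin n) ℝ) l a := by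
    intro a; rw [← h.mul_inv hx, Matrix.mul_apply]; rfl
  calc _ = ∑ a, (∑ m, g x l m * (Matrix.of (g x))⁻¹ m a) * ((1 / 2) *
      (pd i (fun y => g y j a) x + pd j (fun y => g y i a) x - pd a (fun y => g y i j) x)) := by
        simp only [Finset.mul_sum, Finset.sum_mul]
        rw [Finset.sum_comm]
        refine Finset.sum_congr rfl fun a _ => Finset.sum_congr rfl fun m _ => ?_
        rw [h.symm x hx m l]; ring
    _ = _ := by
        simp only [e, Matrix.one_apply]
        simp

theorem MetricOn.compat (h : MetricOn U g) {x} (hx : x ∈ U) (i j l : Fin n) :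
    pd i (fun y => g y j l) x =
      ∑ m, christoffel g x m i j * g x m l + ∑ m, christoffel g x m i l * g x j m := by
  have : ∑ m, christoffel g x m i l * g x j m = ∑ m, christoffel g x m i l * g x m j :=
    Finset.sum_congr rfl fun m _ => by rw [h.symm x hx]
  rw [this, h.lower hx, h.lower hx, h.pd_symm hx i l j]
  ring

theorem MetricOn.chr_trace (h : MetricOn U g) {x} (hx : x ∈ U) (l : Fin n) :
    ∑ i, christoffel g x i i l =
      ∑ i, ∑ a, (1 / 2) * ((Matrix.of (g x))⁻¹ i a * pd l (fun y => g y i a) x) := by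
  have e : ∑ i, ∑ a, (Matrix.of (g x))⁻¹ i a * pd i (fun y => g y l a) x
      = ∑ i, ∑ a, (Matrix.of (g x))⁻¹ i a * pd a (fun y => g y i l) x := by
    rw [Finset.sum_comm]
    refine Finset.sum_congr rfl fun a _ => Finset.sum_congr rfl fun i _ => ?_
    rw [h.inv_symm hx, h.pd_symm hx]
  unfold christoffel
  simp only [← Finset.mul_sum]
  congr 1
  simp only [mul_sub, mul_add, Finset.sum_sub_distrib, Finset.sum_add_distrib]
  rw [e]; ring

theorem MetricOn.pd_chr_trace (h : MetricOn U g) {x} (hx : x ∈ U) (j l : Fin n) :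
    pd j (fun y => ∑ i, christoffel g y i i l) x = pd l (fun y => ∑ i, christoffel g y i i j) x := by
  have hU := h.isOpen
  have hI := inv_smooth h.smooth h.det
  -- matrices of derivatives
  let H := (Matrix.of (g x))⁻¹
  let dG : Fin n → Matrix (Fin n) (Fin n) ℝ := fun k => Matrix.of fun i a => pd k (fun y => g y i a) x
  let dH : Fin n → Matrix (Fin n) (Fin n) ℝ :=
    fun k => Matrix.of fun i a => pd k (fun y => (Matrix.of (g y))⁻¹ i a) x
  have e1 : ∀ k, dH k * Matrix.of (g x) + H * dG k = 0 := by
    intro k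
    ext a d
    have hc : pd k (fun y => ∑ c, (Matrix.of (g y))⁻¹ a c * g y c d) x = 0 := by
      rw [pd_congr hU hx (h := fun _ => (1 : Matrix (Fin n) (Fin n) ℝ) a d), pd_const']
      intro y hy
      rw [← h.inv_mul hy, Matrix.mul_apply]; rfl
    rw [pd_sum' fun c => ((hI a c).mul (h.smooth c d)).diff hU hx] at hc
    simp only [Matrix.add_apply, Matrix.mul_apply, Matrix.zero_apply, ← Finset.sum_add_distrib]
    rw [← hc]
    refine Finset.sum_congr rfl fun c _ => ?_
    rw [pd_mul' ((hI a c).diff hU hx) ((h.smooth c d).diff hU hx)]; rfl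
  have e2 : ∀ k, dH k = - (H * dG k * H) := by
    intro k
    have := congrArg (· * H) (e1 k)
    simp only [add_mul, zero_mul] at this
    rw [mul_assoc, h.mul_inv hx, mul_one] at this
    exact eq_neg_of_add_eq_zero_left this
  have e3 : ∀ j l, pd j (fun y => ∑ i, christoffel g y i i l) x = ∑ i, ∑ a, (1 / 2) *
      (dH j i a * dG l a i + H i a * pd j (pd l (fun y => g y i a)) x) := by
    intro j l
    rw [pd_congr hU hx (fun y hy => h.chr_trace hy l)]
    have hs : ∀ i a, Sm U (fun y => (Matrix.of (g y))⁻¹ i a * pd l (fun y => g y i a) y) :=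
      fun i a => (hI i a).mul ((h.smooth i a).pd hU l)
    rw [pd_sum' fun i => (Sm.sum fun a => (Sm.const _).mul (hs i a)).diff hU hx]
    refine Finset.sum_congr rfl fun i _ => ?_
    rw [pd_sum' fun a => ((Sm.const _).mul (hs i a)).diff hU hx]
    refine Finset.sum_congr rfl fun a _ => ?_
    rw [pd_mul' (differentiableAt_const _) ((hs i a).diff hU hx), pd_const',
      pd_mul' ((hI i a).diff hU hx) (((h.smooth i a).pd hU l).diff hU hx)]
    simp only [dH, dG, H, Matrix.of_apply]
    rw [h.pd_symm hx l a i]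
    ring
  have e4 : ∀ j l, ∑ i, ∑ a, dH j i a * dG l a i = - (H * dG j * (H * dG l)).trace := by
    intro j l
    have : ∑ i, ∑ a, dH j i a * dG l a i = (dH j * dG l).trace := by
      simp [Matrix.trace, Matrix.mul_apply]
    rw [this, e2, neg_mul, Matrix.trace_neg, mul_assoc (H * dG j)]
  rw [e3, e3]
  simp only [← Finset.mul_sum, Finset.sum_add_distrib]
  rw [e4, e4, Matrix.trace_mul_comm]
  congr 2
  refine Finset.sum_congr rfl fun i _ => Finset.sum_congr rfl fun a _ => ?_
  rw [pd_comm (h.smooth i a) hU hx]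

theorem MetricOn.rc_symm (h : MetricOn U g) {x} (hx : x ∈ U) (j l : Fin n) :
    rc (christoffel g) x j l = rc (christoffel g) x l j := by
  have hU := h.isOpen
  have key : ∀ j l, rc (christoffel g) x j l = ∑ i, pd i (fun y => christoffel g y i j l) x
      - pd j (fun y => ∑ i, christoffel g y i i l) x
      + ∑ i, ∑ m, christoffel g x i i m * christoffel g x m j l
      - ∑ i, ∑ m, christoffel g x i j m * christoffel g x m i l := by
    intro j l
    rw [pd_sum' fun i => (h.chr_smooth i i l).diff hU hx]
    simp only [rc, Finset.sum_sub_distrib, Finset.sum_add_distrib]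
    ring
  rw [key, key, h.pd_chr_trace hx j l]
  congr 1
  · congr 1
    · congr 1
      refine Finset.sum_congr rfl fun i _ => ?_
      exact pd_congr hU hx (fun y hy => h.chr_symm hy i j l) i
    · refine Finset.sum_congr rfl fun i _ => Finset.sum_congr rfl fun m _ => ?_
      rw [h.chr_symm hx m j l]
  · rw [Finset.sum_comm]
    refine Finset.sum_congr rfl fun i _ => Finset.sum_congr rfl fun m _ => ?_
    rw [h.chr_symm hx m j i, h.chr_symm hx i m l]; ring

end metric

section semisymm
variable {n : ℕ} {U : Set (Fin n → ℝ)}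

/-- Components of the 1-form `π`. -/
def piC (g : (Fin n → ℝ) → Fin n → Fin n → ℝ) (P : VF n) (x : Fin n → ℝ) (j : Fin n) : ℝ :=
  ∑ a, g x j a * P x a

/-- The difference tensor of the two connections. -/
def aT (g : (Fin n → ℝ) → Fin n → Fin n → ℝ) (P : VF n) (x : Fin n → ℝ) (k i j : Fin n) : ℝ :=
  (if k = i then (1 : ℝ) else 0) * piC g P x j - g x i j * P x k

/-- Coefficients of the semi-symmetric metric connection. -/
noncomputable def barG (g : (Fin n → ℝ) → Fin n → Fin n → ℝ) (P : VF n) (x : Fin n → ℝ)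
    (k i j : Fin n) : ℝ :=
  christoffel g x k i j + aT g P x k i j

theorem gval_pi (g : (Fin n → ℝ) → Fin n → Fin n → ℝ) (P : VF n) (x v : Fin n → ℝ) :
    gval g x v (P x) = ∑ j, piC g P x j * v j := by
  unfold gval piC
  refine Finset.sum_congr rfl fun i _ => ?_
  rw [Finset.sum_mul]
  exact Finset.sum_congr rfl fun j _ => by ring

theorem lcCov_eq (g : (Fin n → ℝ) → Fin n → Fin n → ℝ) : lcCov g = genCov (christoffel g) := rfl

theorem ssCov_eq (g : (Fin n → ℝ) → Fin n → Fin n → ℝ) (P : VF n) :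
    ssCov g P = genCov (barG g P) := by
  funext X Y x k
  unfold ssCov
  rw [gval_pi]
  simp only [lcCov, genCov, barG, aT, gval, add_mul, sub_mul, Finset.sum_add_distrib,
    Finset.sum_sub_distrib]
  have e : ∑ i, ∑ j, (if k = i then (1 : ℝ) else 0) * piC g P x j * X x i * Y x j
      = (∑ j, piC g P x j * Y x j) * X x k := by
    rw [Finset.sum_eq_single k]
    · rw [Finset.sum_mul]; exact Finset.sum_congr rfl fun j _ => by simp; ring
    · intro b _ hb; simp [hb.symm]
    · simp
  rw [e, Finset.sum_mul]
  simp only [Finset.sum_mul]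
  have e2 : ∑ i, ∑ j, g x i j * X x i * Y x j * P x k = ∑ i, ∑ j, g x i j * P x k * X x i * Y x j :=
    Finset.sum_congr rfl fun i _ => Finset.sum_congr rfl fun j _ => by ring
  rw [e2]; ring

/-- Hypotheses in components: metric and unit parallel field. -/
structure ParOn (U : Set (Fin n → ℝ)) (g : (Fin n → ℝ) → Fin n → Fin n → ℝ) (P : VF n) : Prop
    extends MetricOn U g where
  smoothP : SmoothVF U P
  unit : ∀ x ∈ U, ∑ j, piC g P x j * P x j = 1
  par : ∀ x ∈ U, ∀ i k, pd i (fun y => P y k) x = - ∑ m, christoffel g x k i m * P x m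

variable {g : (Fin n → ℝ) → Fin n → Fin n → ℝ} {P : VF n}

theorem ParOn.pi_smooth (h : ParOn U g P) (j : Fin n) : Sm U (fun y => piC g P y j) :=
  Sm.sum fun a => (h.smooth j a).mul (smooth_comp h.smoothP a)

theorem ParOn.aT_smooth (h : ParOn U g P) (k i j : Fin n) : Sm U (fun y => aT g P y k i j) :=
  ((Sm.const _).mul (h.pi_smooth j)).sub ((h.smooth i j).mul (smooth_comp h.smoothP k))

theorem ParOn.bar_smooth (h : ParOn U g P) (k i j : Fin n) : Sm U (fun y => barG g P y k i j) :=
  (h.chr_smooth k i j).add (h.aT_smooth k i j)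

theorem ParOn.pd_pi (h : ParOn U g P) {x} (hx : x ∈ U) (i l : Fin n) :
    pd i (fun y => piC g P y l) x = ∑ m, christoffel g x m i l * piC g P x m := by
  have hU := h.isOpen
  have hPs := smooth_comp h.smoothP
  unfold piC
  rw [pd_sum' fun a => ((h.smooth l a).mul (hPs a)).diff hU hx]
  have e : ∀ a, pd i (fun y => g y l a * P y a) x
      = (∑ m, christoffel g x m i l * g x m a + ∑ m, christoffel g x m i a * g x l m) * P x a
        - g x l a * ∑ m, christoffel g x a i m * P x m := by
    intro a
    rw [pd_mul' ((h.smooth l a).diff hU hx) ((hPs a).diff hU hx), h.compat hx, h.par x hx]; ring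
  simp only [e, Finset.sum_sub_distrib, add_mul, Finset.sum_add_distrib, Finset.sum_mul,
    Finset.mul_sum]
  have e2 : ∑ a, ∑ m, christoffel g x m i a * g x l m * P x a
      = ∑ a, ∑ m, g x l a * (christoffel g x a i m * P x m) := by
    rw [Finset.sum_comm]
    exact Finset.sum_congr rfl fun j _ => Finset.sum_congr rfl fun m _ => by ring
  rw [e2, Finset.sum_comm]
  simp only [← mul_assoc]
  ring

theorem ParOn.pd_aT (h : ParOn U g P) {x} (hx : x ∈ U) (i k j l : Fin n) :
    pd i (fun y => aT g P y k j l) x = - ∑ m, christoffel g x k i m * aT g P x m j l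
      + ∑ m, christoffel g x m i j * aT g P x k m l
      + ∑ m, christoffel g x m i l * aT g P x k j m := by
  have hU := h.isOpen
  have hPs := smooth_comp h.smoothP
  unfold aT
  rw [pd_sub' (((Sm.const _).mul (h.pi_smooth l)).diff hU hx) (((h.smooth j l).mul (hPs k)).diff hU hx),
    pd_mul' (differentiableAt_const _) ((h.pi_smooth l).diff hU hx), pd_const',
    pd_mul' ((h.smooth j l).diff hU hx) ((hPs k).diff hU hx), h.pd_pi hx, h.par x hx, h.compat hx]
  have s1 : ∑ m, christoffel g x k i m * ((if m = j then (1 : ℝ) else 0) * piC g P x l - g x j l * P x m)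
      = christoffel g x k i j * piC g P x l - g x j l * ∑ m, christoffel g x k i m * P x m := by
    simp only [mul_sub, Finset.sum_sub_distrib, Finset.mul_sum]
    congr 1
    · simp
    · exact Finset.sum_congr rfl fun m _ => by ring
  have s2 : ∑ m, christoffel g x m i j * ((if k = m then (1 : ℝ) else 0) * piC g P x l - g x m l * P x k)
      = christoffel g x k i j * piC g P x l - (∑ m, christoffel g x m i j * g x m l) * P x k := by
    simp only [mul_sub, Finset.sum_sub_distrib, Finset.sum_mul]
    congr 1
    · simp
    · exact Finset.sum_congr rfl fun m _ => by ring
  have s3 : ∑ m, christoffel g x m i l * ((if k = j then (1 : ℝ) else 0) * piC g P x m - g x j m * P x k)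
      = (if k = j then (1 : ℝ) else 0) * (∑ m, christoffel g x m i l * piC g P x m)
        - (∑ m, christoffel g x m i l * g x j m) * P x k := by
    simp only [mul_sub, Finset.sum_sub_distrib, Finset.sum_mul, Finset.mul_sum]
    congr 1
    · exact Finset.sum_congr rfl fun m _ => by ring
    · exact Finset.sum_congr rfl fun m _ => by ring
  rw [s1, s2, s3]; ring

theorem ParOn.gP (h : ParOn U g P) {x} (hx : x ∈ U) (j : Fin n) :
    ∑ i, g x i j * P x i = piC g P x j :=
  Finset.sum_congr rfl fun i _ => by rw [h.symm x hx]

theorem ParOn.aa (h : ParOn U g P) {x} (hx : x ∈ U) (j l : Fin n) :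
    ∑ i, ∑ m, (aT g P x i i m * aT g P x m j l - aT g P x i j m * aT g P x m i l)
      = ((n : ℝ) - 2) * (piC g P x j * piC g P x l - g x j l) := by
  have hu := h.unit x hx
  have t1 : ∀ m, ∑ i, aT g P x i i m = ((n : ℝ) - 1) * piC g P x m := by
    intro m
    simp only [aT, Finset.sum_sub_distrib, h.gP hx]
    simp; ring
  have t2 : ∑ m, piC g P x m * aT g P x m j l = piC g P x j * piC g P x l - g x j l := by
    simp only [aT, mul_sub, Finset.sum_sub_distrib]
    have : ∑ m, piC g P x m * (g x j l * P x m) = g x j l * ∑ m, piC g P x m * P x m := by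
      rw [Finset.mul_sum]; exact Finset.sum_congr rfl fun m _ => by ring
    rw [this, hu]; simp
  have t3 : ∀ m, ∑ i, aT g P x i j m * aT g P x m i l =
      piC g P x m * aT g P x m j l - g x j m * ∑ i, P x i * aT g P x m i l := by
    intro m
    conv_lhs => enter [2, i]; rw [aT]
    simp only [sub_mul, Finset.sum_sub_distrib]
    rw [Finset.mul_sum]
    congr 1
    · simp
    · exact Finset.sum_congr rfl fun m _ => by ring
  have t4 : ∀ m, ∑ i, P x i * aT g P x m i l = 0 := by
    intro m
    simp only [aT, mul_sub, Finset.sum_sub_distrib]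
    have : ∑ i, P x i * (g x i l * P x m) = (∑ i, g x i l * P x i) * P x m := by
      rw [Finset.sum_mul]; exact Finset.sum_congr rfl fun m _ => by ring
    rw [this, h.gP hx]; simp; ring
  simp only [Finset.sum_sub_distrib]
  rw [Finset.sum_comm]
  conv_lhs => enter [2]; rw [Finset.sum_comm]
  simp only [t3, t4, ← Finset.sum_mul, t1, mul_zero, sub_zero, t2]
  simp only [mul_assoc, ← Finset.mul_sum, t2]
  ring

theorem ParOn.rc_bar (h : ParOn U g P) {x} (hx : x ∈ U) (j l : Fin n) :
    rc (barG g P) x j l = rc (christoffel g) x j l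
      + ((n : ℝ) - 2) * (piC g P x j * piC g P x l - g x j l) := by
  have hU := h.isOpen
  rw [← h.aa hx]
  unfold rc
  rw [← Finset.sum_add_distrib]
  refine Finset.sum_congr rfl fun i _ => ?_
  have d : ∀ a k j l, pd a (fun y => barG g P y k j l) x
      = pd a (fun y => christoffel g y k j l) x + pd a (fun y => aT g P y k j l) x :=
    fun a k j l => pd_add' ((h.chr_smooth k j l).diff hU hx) ((h.aT_smooth k j l).diff hU hx) a
  rw [d, d, h.pd_aT hx, h.pd_aT hx]
  have s : ∑ m, christoffel g x m j i * aT g P x i m l = ∑ m, christoffel g x m i j * aT g P x i m l :=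
    Finset.sum_congr rfl fun m _ => by rw [h.chr_symm hx]
  rw [s]
  have e : ∑ m, (barG g P x i i m * barG g P x m j l - barG g P x i j m * barG g P x m i l)
      = ∑ m, (christoffel g x i i m * christoffel g x m j l - christoffel g x i j m * christoffel g x m i l)
       + ∑ m, (aT g P x i i m * aT g P x m j l - aT g P x i j m * aT g P x m i l)
       + ∑ m, christoffel g x i i m * aT g P x m j l
       + ∑ m, christoffel g x m j l * aT g P x i i m
       - ∑ m, christoffel g x i j m * aT g P x m i l
       - ∑ m, christoffel g x m i l * aT g P x i j m := by
    simp only [← Finset.sum_add_distrib, ← Finset.sum_sub_distrib]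
    refine Finset.sum_congr rfl fun m _ => ?_
    unfold barG; ring
  rw [e]; ring

theorem lcCov_zero (h : ParOn U g P) {W : VF n} (hW : ∀ y ∈ U, W y = 0) (X : VF n) {x}
    (hx : x ∈ U) : lcCov g X W x = 0 := by
  funext k
  rw [lcCov_eq, genCov_eq]
  refine Finset.sum_eq_zero fun i _ => ?_
  rw [pd_congr h.isOpen hx (h := fun _ => (0 : ℝ)) (fun y hy => by rw [hW y hy]; rfl), pd_const']
  simp [hW x hx]

theorem ParOn.lcP (h : ParOn U g P) (X : VF n) {x} (hx : x ∈ U) : lcCov g X P x = 0 := by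
  funext k
  rw [lcCov_eq, genCov_eq]
  refine Finset.sum_eq_zero fun i _ => ?_
  rw [h.par x hx]; simp

theorem ParOn.rcP (h : ParOn U g P) {x} (hx : x ∈ U) (j : Fin n) :
    ∑ l, rc (christoffel g) x j l * P x l = 0 := by
  have e := ricci_eq h.isOpen h.chr_smooth (smooth_const (U := U) (Pi.single j 1)) h.smoothP hx
  have z : ricci (genCov (christoffel g)) (fun _ => Pi.single j 1) P x = 0 := by
    rw [← lcCov_eq]
    unfold ricci curv
    refine Finset.sum_eq_zero fun i _ => ?_
    rw [lcCov_zero h (fun y hy => h.lcP _ hy) _ hx, lcCov_zero h (fun y hy => h.lcP _ hy) _ hx,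
      h.lcP _ hx]
    simp
  rw [z, Finset.sum_eq_single j] at e
  · simpa using e.symm
  · intro b _ hb; simp [hb]
  · simp

/-- Components of the Ricci tensor of the semi-symmetric metric connection, on `U`. -/
noncomputable def tH (g : (Fin n → ℝ) → Fin n → Fin n → ℝ) (P : VF n) (x : Fin n → ℝ)
    (j l : Fin n) : ℝ :=
  rc (christoffel g) x j l + ((n : ℝ) - 2) * (piC g P x j * piC g P x l - g x j l)

theorem ParOn.ric_bar (h : ParOn U g P) {Y Z : VF n} (hY : SmoothVF U Y) (hZ : SmoothVF U Z)
    {x} (hx : x ∈ U) :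
    ricci (ssCov g P) Y Z x = ∑ j, ∑ l, tH g P x j l * Y x j * Z x l := by
  rw [ssCov_eq, ricci_eq h.isOpen h.bar_smooth hY hZ hx]
  simp only [h.rc_bar hx, tH]

theorem ParOn.tH_symm (h : ParOn U g P) {x} (hx : x ∈ U) (j l : Fin n) :
    tH g P x j l = tH g P x l j := by
  unfold tH; rw [h.rc_symm hx, h.symm x hx j l]; ring

theorem ParOn.ric_bar_symm (h : ParOn U g P) {Y Z : VF n} (hY : SmoothVF U Y) (hZ : SmoothVF U Z)
    {x} (hx : x ∈ U) : ricci (ssCov g P) Y Z x = ricci (ssCov g P) Z Y x := by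
  rw [h.ric_bar hY hZ hx, h.ric_bar hZ hY hx, Finset.sum_comm]
  refine Finset.sum_congr rfl fun j _ => Finset.sum_congr rfl fun l _ => ?_
  rw [h.tH_symm hx]; ring

theorem ParOn.shat_eq (h : ParOn U g P) {Y Z : VF n} (hY : SmoothVF U Y) (hZ : SmoothVF U Z)
    {x} (hx : x ∈ U) :
    shat g P Y Z x = ∑ j, ∑ l, tH g P x j l * Y x j * Z x l := by
  unfold shat; rw [h.ric_bar_symm hZ hY hx, h.ric_bar hY hZ hx]; ring

theorem ParOn.tH_smooth (h : ParOn U g P) (j l : Fin n) : Sm U (fun y => tH g P y j l) :=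
  (rc_smooth h.isOpen h.chr_smooth j l).add
    ((Sm.const _).mul (((h.pi_smooth j).mul (h.pi_smooth l)).sub (h.smooth j l)))

theorem ParOn.tHP (h : ParOn U g P) {x} (hx : x ∈ U) (l : Fin n) :
    ∑ m, P x m * tH g P x m l = 0 := by
  have e : ∑ m, P x m * tH g P x m l = ∑ m, rc (christoffel g) x l m * P x m
      + ((n : ℝ) - 2) * ((∑ m, piC g P x m * P x m) * piC g P x l - ∑ m, g x m l * P x m) := by
    rw [Finset.sum_mul, ← Finset.sum_sub_distrib, Finset.mul_sum, ← Finset.sum_add_distrib]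
    refine Finset.sum_congr rfl fun m _ => ?_
    unfold tH; rw [h.rc_symm hx m l]; ring
  rw [e, h.rcP hx, h.unit x hx, h.gP hx]; ring

theorem ParOn.aT_tH (h : ParOn U g P) {x} (hx : x ∈ U) (i j l : Fin n) :
    ∑ m, aT g P x m i j * tH g P x m l = piC g P x j * tH g P x i l := by
  have e : ∑ m, aT g P x m i j * tH g P x m l = piC g P x j * tH g P x i l
      - g x i j * ∑ m, P x m * tH g P x m l := by
    simp only [aT, sub_mul, Finset.sum_sub_distrib, Finset.mul_sum]
    congr 1
    · simp
    · exact Finset.sum_congr rfl fun m _ => by ring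
  rw [e, h.tHP hx]; ring

theorem ParOn.comp (h : ParOn U g P) {x} (hx : x ∈ U) (i j l : Fin n) :
    pd i (fun y => tH g P y j l) x - ∑ m, barG g P x m i j * tH g P x m l
        - ∑ m, barG g P x m i l * tH g P x j m
      = (pd i (fun y => rc (christoffel g) y j l) x
        - ∑ m, christoffel g x m i j * rc (christoffel g) x m l
        - ∑ m, christoffel g x m i l * rc (christoffel g) x j m)
        - piC g P x j * tH g P x i l - piC g P x l * tH g P x i j := by
  have hU := h.isOpen
  have a1 := h.aT_tH hx i j l
  have a2 : ∑ m, aT g P x m i l * tH g P x j m = piC g P x l * tH g P x i j := by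
    rw [← h.aT_tH hx i l j]
    exact Finset.sum_congr rfl fun m _ => by rw [h.tH_symm hx]
  have d : pd i (fun y => tH g P y j l) x = pd i (fun y => rc (christoffel g) y j l) x
      + ((n : ℝ) - 2) * ((∑ m, christoffel g x m i j * piC g P x m) * piC g P x l
        + piC g P x j * (∑ m, christoffel g x m i l * piC g P x m)
        - (∑ m, christoffel g x m i j * g x m l + ∑ m, christoffel g x m i l * g x j m)) := by
    have hpp := (h.pi_smooth j).mul (h.pi_smooth l)
    unfold tH
    rw [pd_add' ((rc_smooth hU h.chr_smooth j l).diff hU hx)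
      (((Sm.const _).mul (hpp.sub (h.smooth j l))).diff hU hx),
      pd_mul' (differentiableAt_const _) ((hpp.sub (h.smooth j l)).diff hU hx), pd_const',
      pd_sub' (hpp.diff hU hx) ((h.smooth j l).diff hU hx),
      pd_mul' ((h.pi_smooth j).diff hU hx) ((h.pi_smooth l).diff hU hx),
      h.pd_pi hx, h.pd_pi hx, h.compat hx]
    ring
  have b1 : ∑ m, christoffel g x m i j * tH g P x m l
      = ∑ m, christoffel g x m i j * rc (christoffel g) x m l
        + ((n : ℝ) - 2) * ((∑ m, christoffel g x m i j * piC g P x m) * piC g P x l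
          - ∑ m, christoffel g x m i j * g x m l) := by
    rw [Finset.sum_mul, ← Finset.sum_sub_distrib, Finset.mul_sum, ← Finset.sum_add_distrib]
    exact Finset.sum_congr rfl fun m _ => by unfold tH; ring
  have b2 : ∑ m, christoffel g x m i l * tH g P x j m
      = ∑ m, christoffel g x m i l * rc (christoffel g) x j m
        + ((n : ℝ) - 2) * (piC g P x j * (∑ m, christoffel g x m i l * piC g P x m)
          - ∑ m, christoffel g x m i l * g x j m) := by
    rw [Finset.mul_sum, ← Finset.sum_sub_distrib, Finset.mul_sum, ← Finset.sum_add_distrib]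
    exact Finset.sum_congr rfl fun m _ => by unfold tH; ring
  simp only [barG, add_mul, Finset.sum_add_distrib]
  rw [a1, a2, d, b1, b2]; ring

theorem ParOn.main (h : ParOn U g P) {X Y Z : VF n} (hX : SmoothVF U X) (hY : SmoothVF U Y)
    (hZ : SmoothVF U Z) {x} (hx : x ∈ U) :
    covT (ssCov g P) (shat g P) X Y Z x = covT (lcCov g) (ricci (lcCov g)) X Y Z x
      - gval g x (Y x) (P x) * ricci (ssCov g P) X Z x
      - gval g x (Z x) (P x) * ricci (ssCov g P) X Y x := by
  rw [h.ric_bar hX hZ hx, h.ric_bar hX hY hx, ssCov_eq, lcCov_eq,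
    covT_eq h.isOpen h.bar_smooth h.tH_smooth (fun Y Z hY hZ x hx => h.shat_eq hY hZ hx) hX hY hZ hx,
    covT_eq h.isOpen h.chr_smooth (rc_smooth h.isOpen h.chr_smooth)
      (fun Y Z hY hZ x hx => ricci_eq h.isOpen h.chr_smooth hY hZ hx) hX hY hZ hx,
    gval_pi, gval_pi]
  simp only [h.comp hx]
  have e1 : (∑ j, piC g P x j * Y x j) * (∑ i, ∑ l, tH g P x i l * X x i * Z x l)
      = ∑ i, ∑ j, ∑ l, piC g P x j * tH g P x i l * X x i * Y x j * Z x l := by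
    simp only [Finset.sum_mul, Finset.mul_sum]
    refine Finset.sum_congr rfl fun i _ => ?_
    rw [Finset.sum_comm]
    refine Finset.sum_congr rfl fun j _ => Finset.sum_congr rfl fun l _ => by ring
  have e2 : (∑ l, piC g P x l * Z x l) * (∑ i, ∑ j, tH g P x i j * X x i * Y x j)
      = ∑ i, ∑ j, ∑ l, piC g P x l * tH g P x i j * X x i * Y x j * Z x l := by
    simp only [Finset.sum_mul, Finset.mul_sum]
    refine Finset.sum_congr rfl fun i _ => ?_
    refine Finset.sum_congr rfl fun j _ => Finset.sum_congr rfl fun l _ => by ring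
  rw [e1, e2]
  simp only [← Finset.sum_sub_distrib]
  refine Finset.sum_congr rfl fun i _ => Finset.sum_congr rfl fun j _ =>
    Finset.sum_congr rfl fun l _ => by ring

end semisymm

/-- On an open `U ⊆ ℝⁿ` (`n ≥ 3`) with Riemannian metric `g`, Levi-Civita
connection `∇`, vector field `P`, `π(X) = g(X,P)`, semi-symmetric metric connection `∇̄`,
`S = Ric_∇`, `S̄ = Ric_∇̄`, `Ŝ = sym S̄`: suppose `P` is a unit parallel vector field
(`g(P,P) = 1` and `∇_X P = 0` for all vector fields `X`).  Then `∇S ≡ 0` if and only if for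
all vector fields `X, Y, Z`: `(∇̄_X Ŝ)(Y,Z) = −π(Y)S̄(X,Z) − π(Z)S̄(X,Y)`. -/
theorem statement7 (n : ℕ) (hn : 3 ≤ n)
    (U : Set (Fin n → ℝ)) (hU : IsOpen U)
    (g : (Fin n → ℝ) → Fin n → Fin n → ℝ) (hg : SmoothVF U g)
    (hgpos : ∀ x ∈ U, (Matrix.of (g x)).PosDef)
    (P : VF n) (hP : SmoothVF U P)
    (hPunit : ∀ x ∈ U, gval g x (P x) (P x) = 1)
    (hParallel : ∀ X : VF n, SmoothVF U X → ∀ x ∈ U, lcCov g X P x = 0) :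
    (∀ X Y Z : VF n, SmoothVF U X → SmoothVF U Y → SmoothVF U Z → ∀ x ∈ U,
        covT (lcCov g) (ricci (lcCov g)) X Y Z x = 0) ↔
      (∀ X Y Z : VF n, SmoothVF U X → SmoothVF U Y → SmoothVF U Z → ∀ x ∈ U,
        covT (ssCov g P) (shat g P) X Y Z x =
          -(gval g x (Y x) (P x) * ricci (ssCov g P) X Z x)
            - gval g x (Z x) (P x) * ricci (ssCov g P) X Y x) := by
  have h : ParOn U g P :=
    { isOpen := hU
      smooth := fun i j => contDiffOn_pi.1 (contDiffOn_pi.1 hg i) j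
      symm := fun x hx i j => by
        have := (hgpos x hx).isHermitian.apply j i
        simpa using this
      det := fun x hx => (hgpos x hx).det_pos.ne'
      smoothP := hP
      unit := fun x hx => by rw [← gval_pi]; exact hPunit x hx
      par := fun x hx i k => by
        have := congrFun (hParallel (fun _ => Pi.single i 1) (smooth_const _) x hx) k
        rw [lcCov_eq, genCov_single] at this
        exact eq_neg_of_add_eq_zero_left this }
  constructor
  · intro H X Y Z hX hY hZ x hx
    rw [h.main hX hY hZ hx, H X Y Z hX hY hZ x hx]; ring
  · intro H X Y Z hX hY hZ x hx
    have := H X Y Z hX hY hZ x hx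
    rw [h.main hX hY hZ hx] at this
    linarith
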